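/- Let f : ℝ → ℝ be smooth with max(sup_t |f(t)|, sup_t |f'(t)|, sup_t |f''(t)|) ≤ C. For any a > 1 and r ∈ ℝ there exists a smooth function g with g'(0) = r, g(t) = f(t) for all |t| ≥ 1/a, and max(sup_t |g(t)|, sup_t |g'(t)|, sup_t |g''(t)|) ≤ C + 16·a·|r − f'(0)|. -/

import Mathlib

/-- The integral of a continuous function over a sliding window is differentiable. -/
theorem hasDerivAt_integral_window {u : ℝ → ℝ} (hu : Continuous u) (p q t : ℝ) :
    HasDerivAt (fun x => ∫ s in (x + p)..(x + q), u s) (u (t + q) - u (t + p)) t := by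
  have key : ∀ c : ℝ, HasDerivAt (fun x => ∫ s in (0 : ℝ)..(x + c), u s) (u (t + c)) t := fun c =>
    ((hu.integral_hasStrictDerivAt 0 (t + c)).hasDerivAt).comp_add_const t c
  refine ((key q).sub (key p)).congr_of_eventuallyEq (Filter.Eventually.of_forall fun x => ?_)
  exact (intervalIntegral.integral_interval_sub_left
    (hu.intervalIntegrable _ _) (hu.intervalIntegrable _ _)).symm

theorem contDiff_integral_window {u : ℝ → ℝ} (hu : ContDiff ℝ (⊤ : ℕ∞) u) (p q : ℝ) :
    ContDiff ℝ (⊤ : ℕ∞) (fun x => ∫ s in (x + p)..(x + q), u s) := by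
  refine contDiff_infty_iff_deriv.2
    ⟨fun t => (hasDerivAt_integral_window hu.continuous p q t).differentiableAt, ?_⟩
  rw [show deriv (fun x => ∫ s in (x + p)..(x + q), u s) = fun t => u (t + q) - u (t + p) from
    funext fun t => (hasDerivAt_integral_window hu.continuous p q t).deriv]
  exact (hu.comp (contDiff_id.add contDiff_const)).sub (hu.comp (contDiff_id.add contDiff_const))

theorem abs_integral_window_le {u : ℝ → ℝ} {M : ℝ} (hM : ∀ s, |u s| ≤ M) (p q t : ℝ) :
    |∫ s in (t + p)..(t + q), u s| ≤ M * |q - p| := by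
  have h := intervalIntegral.norm_integral_le_of_norm_le_const (a := t + p) (b := t + q)
    (f := u) (C := M) fun s _ => hM s
  rwa [add_sub_add_left_eq_sub] at h

theorem integral_window_eq_zero {u : ℝ → ℝ} {p q t : ℝ} (hpq : p ≤ q)
    (hu : ∀ s, t + p ≤ s → s ≤ t + q → u s = 0) : ∫ s in (t + p)..(t + q), u s = 0 := by
  rw [intervalIntegral.integral_congr (g := fun _ => (0 : ℝ)), intervalIntegral.integral_zero]
  intro s hs
  rw [Set.uIcc_of_le (by linarith)] at hs
  exact hu s hs.1 hs.2

/-- A smooth function with values in `[0, 1]` and support in `[-1/6, 1/6]` whose integral is not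
too small. -/
theorem exists_smooth_bump_integral_ge :
    ∃ u : ℝ → ℝ, ContDiff ℝ (⊤ : ℕ∞) u ∧ (∀ s, 0 ≤ u s ∧ u s ≤ 1) ∧ (∀ s, 1 / 6 ≤ |s| → u s = 0) ∧
      1 / 6 ≤ ∫ s in (-(1 / 6) : ℝ)..(1 / 6), u s := by
  let b : ContDiffBump (0 : ℝ) := ⟨1 / 12, 1 / 6, by norm_num, by norm_num⟩
  refine ⟨b, b.contDiff, fun s => ⟨b.nonneg, b.le_one⟩, fun s hs => b.zero_of_le_dist ?_, ?_⟩
  · simpa [Real.dist_eq, b] using hs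
  · have h1 : ∫ s in (-(1 / 12) : ℝ)..(1 / 12), b s = 1 / 6 := by
      rw [intervalIntegral.integral_congr (g := fun _ => (1 : ℝ))]
      · norm_num
      · intro s hs
        rw [Set.uIcc_of_le (by norm_num)] at hs
        refine b.one_of_mem_closedBall ?_
        rw [Metric.mem_closedBall, Real.dist_eq, sub_zero]
        exact abs_le.2 hs
    refine h1.ge.trans ?_
    exact intervalIntegral.integral_mono_interval (by norm_num) (by norm_num) (by norm_num)
      (Filter.Eventually.of_forall fun s => b.nonneg) (b.continuous.intervalIntegrable _ _)

/-- A smooth function supported in `[-1, 1]` with derivative `1` at the origin and explicit bounds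
on its first two derivatives. -/
theorem exists_smooth_unit_slope :
    ∃ φ : ℝ → ℝ, ContDiff ℝ (⊤ : ℕ∞) φ ∧ deriv φ 0 = 1 ∧ (∀ t, 1 ≤ |t| → φ t = 0) ∧
      ∀ t, |φ t| ≤ 16 ∧ |deriv φ t| ≤ 16 ∧ |deriv (deriv φ) t| ≤ 16 := by
  obtain ⟨u, hu, hu01, hu0, hI⟩ := exists_smooth_bump_integral_ge
  set I := ∫ s in (-(1 / 6) : ℝ)..(1 / 6), u s with hIdef
  have hIpos : 0 < I := by linarith
  have hIinv : I⁻¹ ≤ 6 := by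
    rw [inv_le_comm₀ hIpos (by norm_num)]; linarith
  set v : ℝ → ℝ := fun s => I⁻¹ * u s with hv
  have hvc : ContDiff ℝ (⊤ : ℕ∞) v := contDiff_const.mul hu
  have hv6 : ∀ s, 0 ≤ v s ∧ v s ≤ 6 := fun s =>
    ⟨mul_nonneg (inv_nonneg.2 hIpos.le) (hu01 s).1,
      (mul_le_of_le_one_right (inv_nonneg.2 hIpos.le) (hu01 s).2).trans hIinv⟩
  have hv0 : ∀ s, 1 / 6 ≤ |s| → v s = 0 := fun s hs => by simp [hv, hu0 s hs]
  set h : ℝ → ℝ := fun t => ∫ s in (t + -(1 / 6))..(t + 1 / 6), v s with hh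
  have hhc : ContDiff ℝ (⊤ : ℕ∞) h := contDiff_integral_window hvc _ _
  have hh0 : ∀ t, 1 / 3 ≤ |t| → h t = 0 := fun t ht => by
    refine integral_window_eq_zero (by norm_num) fun s h1 h2 => hv0 s ?_
    rcases le_abs.1 ht with ht | ht
    · exact le_abs.2 (Or.inl (by linarith))
    · exact le_abs.2 (Or.inr (by linarith))
  have hh1 : h 0 = 1 := by
    simp only [hh, hv, zero_add]
    rw [intervalIntegral.integral_const_mul, ← hIdef, inv_mul_cancel₀ hIpos.ne']
  have hhb : ∀ t, |h t| ≤ 2 := fun t => by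
    have := abs_integral_window_le (M := 6)
      (fun s => abs_le.2 ⟨by linarith [(hv6 s).1], (hv6 s).2⟩) (-(1 / 6)) (1 / 6) t
    refine this.trans ?_
    norm_num [abs_of_pos]
  have hhd : ∀ t, HasDerivAt h (v (t + 1 / 6) - v (t + -(1 / 6))) t :=
    hasDerivAt_integral_window hvc.continuous _ _
  have hφd := hasDerivAt_integral_window hhc.continuous (-(2 / 3)) 0
  have hφd' := funext fun t => (hφd t).deriv
  refine ⟨_, contDiff_integral_window hhc (-(2 / 3)) 0, ?_, fun t ht => ?_, fun t => ⟨?_, ?_, ?_⟩⟩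
  · rw [(hφd 0).deriv, hh0 (0 + -(2 / 3)) (by norm_num [abs_of_pos]), add_zero, hh1, sub_zero]
  · refine integral_window_eq_zero (by norm_num) fun s h1 h2 => hh0 s ?_
    rcases le_abs.1 ht with ht | ht
    · exact le_abs.2 (Or.inl (by linarith))
    · exact le_abs.2 (Or.inr (by linarith))
  · refine (abs_integral_window_le hhb _ _ t).trans ?_
    norm_num [abs_of_pos]
  · rw [(hφd t).deriv]
    linarith [abs_sub (h (t + 0)) (h (t + -(2 / 3))), hhb (t + 0), hhb (t + -(2 / 3))]
  · rw [hφd', (((hhd (t + 0)).comp_add_const t 0).fun_sub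
      ((hhd (t + -(2 / 3))).comp_add_const t (-(2 / 3)))).deriv]
    have h1 := hv6 (t + 0 + 1 / 6)
    have h2 := hv6 (t + 0 + -(1 / 6))
    have h3 := hv6 (t + -(2 / 3) + 1 / 6)
    have h4 := hv6 (t + -(2 / 3) + -(1 / 6))
    rw [abs_le]
    constructor <;> linarith

theorem stmt_3 (C : ℝ) (f : ℝ → ℝ) (hf : ContDiff ℝ (⊤ : ℕ∞) f)
    (hbd : ∀ t, |f t| ≤ C ∧ |deriv f t| ≤ C ∧ |deriv (deriv f) t| ≤ C)
    (a r : ℝ) (ha : 1 < a) :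
    ∃ g : ℝ → ℝ, ContDiff ℝ (⊤ : ℕ∞) g ∧ deriv g 0 = r ∧
      (∀ t, 1/a ≤ |t| → g t = f t) ∧
      (∀ t, |g t| ≤ C + 16*a*|r - deriv f 0| ∧
            |deriv g t| ≤ C + 16*a*|r - deriv f 0| ∧
            |deriv (deriv g) t| ≤ C + 16*a*|r - deriv f 0|) := by
  obtain ⟨φ, hφ, hφ1, hφ0, hφb⟩ := exists_smooth_unit_slope
  have ha0 : 0 < a := by linarith
  set d := r - deriv f 0 with hd
  have hf' := (contDiff_infty_iff_deriv.1 hf)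
  have hφ' := (contDiff_infty_iff_deriv.1 hφ)
  have hf'' := (contDiff_infty_iff_deriv.1 hf'.2).1
  have hφ'' := (contDiff_infty_iff_deriv.1 hφ'.2).1
  have scale : ∀ (ψ : ℝ → ℝ), Differentiable ℝ ψ → ∀ t,
      HasDerivAt (fun x => ψ (a * x)) (deriv ψ (a * t) * a) t := fun ψ hψ t => by
    have := (hψ (a * t)).hasDerivAt.comp t ((hasDerivAt_id t).const_mul a)
    rwa [mul_one] at this
  have hg1 : ∀ t, HasDerivAt (fun x => f x + d / a * φ (a * x))
      (deriv f t + d * deriv φ (a * t)) t := fun t => by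
    refine ((hf'.1 t).hasDerivAt.add ((scale φ hφ'.1 t).const_mul (d / a))).congr_deriv ?_
    field_simp
  have hg1' := funext fun t => (hg1 t).deriv
  have hg2 : ∀ t, HasDerivAt (fun x => deriv f x + d * deriv φ (a * x))
      (deriv (deriv f) t + d * a * deriv (deriv φ) (a * t)) t := fun t => by
    refine ((hf'' t).hasDerivAt.add ((scale _ hφ'' t).const_mul d)).congr_deriv ?_
    ring
  have bound : ∀ x c y : ℝ, |x| ≤ C → |c| ≤ a * |d| → |y| ≤ 16 →
      |x + c * y| ≤ C + 16 * a * |d| := fun x c y hx hc hy => by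
    have h1 : |c * y| ≤ a * |d| * 16 := by
      rw [abs_mul]; gcongr
    linarith [abs_add_le x (c * y)]
  have hda : |d| ≤ a * |d| := le_mul_of_one_le_left (abs_nonneg d) ha.le
  refine ⟨fun x => f x + d / a * φ (a * x), ?_, ?_, fun t ht => ?_, fun t => ⟨?_, ?_, ?_⟩⟩
  · exact hf.add (contDiff_const.mul (hφ.comp (contDiff_const.mul contDiff_id)))
  · rw [(hg1 0).deriv, mul_zero, hφ1, hd]; ring
  · have : 1 ≤ |a * t| := by
      rw [abs_mul, abs_of_pos ha0]
      rwa [div_le_iff₀' ha0] at ht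
    simp [hφ0 _ this]
  · refine bound _ _ _ (hbd t).1 ?_ (hφb _).1
    rw [abs_div, abs_of_pos ha0]
    exact (div_le_self (abs_nonneg d) ha.le).trans hda
  · rw [(hg1 t).deriv]
    exact bound _ _ _ (hbd t).2.1 hda (hφb _).2.1
  · rw [hg1', (hg2 t).deriv]
    refine bound _ _ _ (hbd t).2.2 ?_ (hφb _).2.2
    rw [abs_mul, abs_of_pos ha0, mul_comm]
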